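/- Let k be a field of characteristic p > 0 and A a finite-dimensional associative unital k-algebra. If D is an integrable ([1,∞]-integrable) k-derivation on A, then the p-fold composite D^p (which is again a k-derivation since char k = p) is integrable; that is, the integrable derivations form a restricted Lie subalgebra of the restricted Lie algebra of all k-derivations on A. -/

import Mathlib

/-- A `k`-derivation on an associative unital `k`-algebra `A`: a `k`-linear map
satisfying the Leibniz rule. -/
def IsDerivation (k A : Type*) [CommRing k] [Ring A] [Algebra k A]
    (D : A →ₗ[k] A) : Prop :=
  ∀ x y : A, D (x * y) = D x * y + x * D y

/-- `D` is `[m,n)`-integrable: there is a family `α_0 = id, α_1, …, α_{n-1}` of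
`k`-linear endomorphisms of `A` with `α_i = 0` for `0 < i < m`, `α_m = D`, and
satisfying the Hasse–Schmidt convolution identities for all `i < n`. -/
def IsFinIntegrable (k A : Type*) [CommRing k] [Ring A] [Algebra k A]
    (m n : ℕ) (D : A →ₗ[k] A) : Prop :=
  ∃ α : ℕ → (A →ₗ[k] A),
    α 0 = LinearMap.id ∧
    (∀ i, 0 < i → i < m → α i = 0) ∧
    α m = D ∧
    ∀ i, i < n → ∀ x y : A,
      α i (x * y) = ∑ j ∈ Finset.range (i + 1), α j x * α (i - j) y

/-- `D` is `[m,∞]`-integrable: an infinite Hasse–Schmidt family exists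
(equivalently, an automorphism of `A⟦t⟧` congruent to `1` mod `t^m` with
`t^m`-coefficient `D`). -/
def IsInfIntegrable (k A : Type*) [CommRing k] [Ring A] [Algebra k A]
    (m : ℕ) (D : A →ₗ[k] A) : Prop :=
  ∃ α : ℕ → (A →ₗ[k] A),
    α 0 = LinearMap.id ∧
    (∀ i, 0 < i → i < m → α i = 0) ∧
    α m = D ∧
    ∀ i, ∀ x y : A,
      α i (x * y) = ∑ j ∈ Finset.range (i + 1), α j x * α (i - j) y

namespace HasseSchmidt

open Finset
open scoped TensorProduct

lemma nsmul_left_cancel {σ : Type*} {w : σ →₀ ℕ} (hw : w ≠ 0) {a b : ℕ} (h : a • w = b • w) :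
    a = b := by
  obtain ⟨i, hi⟩ := Finsupp.ne_iff.1 hw
  exact Nat.eq_of_mul_eq_mul_right (Nat.pos_of_ne_zero hi) (by simpa using DFunLike.congr_fun h i)

section Substitution

variable {k : Type*} [CommRing k] {σ : Type*}

/-- The substitution `∑ γ_n Xⁿ ↦ ∑ γ_n φⁿ` of a multivariate power series `φ` with central
coefficients and zero constant term. -/
noncomputable def subst {R : Type*} [Ring R] [Algebra k R] (φ : MvPowerSeries σ k)
    (γ : PowerSeries R) : MvPowerSeries σ R :=
  fun d => ∑ n ∈ range (d.degree + 1), MvPowerSeries.coeff d (φ ^ n) • PowerSeries.coeff n γ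

variable {R S : Type*} [Ring R] [Algebra k R] [Ring S] [Algebra k S]

lemma coeff_subst (φ : MvPowerSeries σ k) (γ : PowerSeries R) (d : σ →₀ ℕ) :
    MvPowerSeries.coeff d (subst φ γ) =
      ∑ n ∈ range (d.degree + 1), MvPowerSeries.coeff d (φ ^ n) • PowerSeries.coeff n γ := rfl

lemma coeff_pow_eq_zero {φ : MvPowerSeries σ k} (hφ : MvPowerSeries.constantCoeff φ = 0)
    {d : σ →₀ ℕ} {n : ℕ} (h : d.degree < n) : MvPowerSeries.coeff d (φ ^ n) = 0 :=
  MvPowerSeries.coeff_eq_zero_of_constantCoeff_nilpotent (m := 1) (by simpa using hφ) (by omega)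

lemma coeff_subst_of_le {φ : MvPowerSeries σ k} (hφ : MvPowerSeries.constantCoeff φ = 0)
    (γ : PowerSeries R) {d : σ →₀ ℕ} {N : ℕ} (hN : d.degree ≤ N) :
    MvPowerSeries.coeff d (subst φ γ) =
      ∑ n ∈ range (N + 1), MvPowerSeries.coeff d (φ ^ n) • PowerSeries.coeff n γ := by
  rw [coeff_subst]
  refine sum_subset (range_mono (by omega)) fun n _ hn => ?_
  rw [coeff_pow_eq_zero hφ (by simpa using hn), zero_smul]

lemma subst_mul {φ : MvPowerSeries σ k} (hφ : MvPowerSeries.constantCoeff φ = 0)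
    (γ γ' : PowerSeries R) : subst φ (γ * γ') = subst φ γ * subst φ γ' := by
  classical
  ext d
  set N := d.degree
  have hl : MvPowerSeries.coeff d (subst φ (γ * γ')) = ∑ x ∈ range (N + 1) ×ˢ range (N + 1),
      MvPowerSeries.coeff d (φ ^ (x.1 + x.2)) •
        (PowerSeries.coeff x.1 γ * PowerSeries.coeff x.2 γ') := by
    rw [coeff_subst]
    simp only [PowerSeries.coeff_mul, smul_sum]
    rw [sum_sigma']
    refine sum_subset_zero_on_sdiff (s₂ := range (N + 1) ×ˢ range (N + 1))
      (s₁ := (range (N + 1) ×ˢ range (N + 1)).filter fun x => x.1 + x.2 ≤ N) (filter_subset _ _)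
      (fun x hx => ?_) (fun x _ => rfl) |>.symm.trans ?_ |>.symm
    · simp only [mem_sdiff, mem_filter, not_and, not_le] at hx
      rw [coeff_pow_eq_zero hφ (hx.2 hx.1), zero_smul]
    · refine sum_bij' (fun x _ => ⟨x.1 + x.2, x⟩) (fun x _ => x.2) ?_ ?_ ?_ ?_ ?_
      · intro x hx
        simp only [mem_filter, mem_product, mem_range] at hx
        simp only [mem_sigma, mem_range, HasAntidiagonal.mem_antidiagonal, and_true]
        omega
      · rintro ⟨l, x⟩ hx
        simp only [mem_sigma, mem_range, HasAntidiagonal.mem_antidiagonal] at hx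
        simp only [mem_filter, mem_product, mem_range]
        omega
      · simp
      · rintro ⟨l, x⟩ hx
        simp only [mem_sigma, HasAntidiagonal.mem_antidiagonal] at hx
        simp [hx.2]
      · simp
  rw [hl, MvPowerSeries.coeff_mul]
  have hr : ∀ x ∈ antidiagonal d, MvPowerSeries.coeff x.1 (subst φ γ) *
      MvPowerSeries.coeff x.2 (subst φ γ') = ∑ y ∈ range (N + 1) ×ˢ range (N + 1),
        (MvPowerSeries.coeff x.1 (φ ^ y.1) * MvPowerSeries.coeff x.2 (φ ^ y.2)) •
          (PowerSeries.coeff y.1 γ * PowerSeries.coeff y.2 γ') := by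
    intro x hx
    have hx' : x.1.degree + x.2.degree = N := by
      rw [← map_add, HasAntidiagonal.mem_antidiagonal.1 hx]
    rw [coeff_subst_of_le hφ γ (N := N) (by omega), coeff_subst_of_le hφ γ' (N := N) (by omega),
      sum_mul_sum, ← sum_product']
    simp only [smul_mul_smul_comm]
  rw [sum_congr rfl hr, sum_comm]
  refine sum_congr rfl fun y _ => ?_
  rw [pow_add, MvPowerSeries.coeff_mul, sum_smul]

lemma map_subst (f : R →ₐ[k] S) (φ : MvPowerSeries σ k) (γ : PowerSeries R) :
    subst φ (PowerSeries.map (f : R →+* S) γ) = MvPowerSeries.map (f : R →+* S) (subst φ γ) := by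
  ext d
  simp [coeff_subst]

lemma coeff_zero_subst (φ : MvPowerSeries σ k) (γ : PowerSeries R) :
    MvPowerSeries.coeff 0 (subst φ γ) = PowerSeries.coeff 0 γ := by
  simp [coeff_subst]

lemma coeff_subst_monomial_smul {w : σ →₀ ℕ} (hw : w ≠ 0) (γ : PowerSeries R) (c : ℕ) :
    MvPowerSeries.coeff (c • w) (subst (MvPowerSeries.monomial w (1 : k)) γ) =
      PowerSeries.coeff c γ := by
  classical
  rw [coeff_subst, sum_eq_single c]
  · simp [MvPowerSeries.monomial_pow]
  · intro n _ hn
    rw [MvPowerSeries.monomial_pow, MvPowerSeries.coeff_monomial_ne, zero_smul]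
    exact fun h => hn (nsmul_left_cancel hw h).symm
  · intro hc
    exact absurd (mem_range.2 (Nat.lt_succ_of_le (by
      rw [map_nsmul, smul_eq_mul]
      exact Nat.le_mul_of_pos_right _
        (Nat.pos_of_ne_zero ((Finsupp.degree_eq_zero_iff w).not.2 hw))))) hc

lemma coeff_subst_monomial_of_forall_ne {w d : σ →₀ ℕ} (h : ∀ c : ℕ, c • w ≠ d)
    (γ : PowerSeries R) :
    MvPowerSeries.coeff d (subst (MvPowerSeries.monomial w (1 : k)) γ) = 0 := by
  classical
  rw [coeff_subst]
  refine sum_eq_zero fun n _ => ?_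
  rw [MvPowerSeries.monomial_pow, MvPowerSeries.coeff_monomial_ne (h n).symm, zero_smul]

end Substitution

section Defect

variable (k A : Type*) [CommRing k] [Ring A] [Algebra k A]

/-- `f ↦ f ⊗ id` as a homomorphism of algebras. -/
noncomputable def rightTensor : Module.End k A →ₐ[k] Module.End k (A ⊗[k] A) :=
  AlgHom.ofLinearMap (LinearMap.rTensorHom A) (LinearMap.rTensor_id A A)
    fun f g => LinearMap.rTensor_mul A f g

/-- `f ↦ id ⊗ f` as a homomorphism of algebras. -/
noncomputable def leftTensor : Module.End k A →ₐ[k] Module.End k (A ⊗[k] A) :=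
  AlgHom.ofLinearMap (LinearMap.lTensorHom A) (LinearMap.lTensor_id A A)
    fun f g => LinearMap.lTensor_mul A f g

/-- The multiplication of `A`, as an endomorphism of `A × (A ⊗ A)`. -/
noncomputable def mulEnd : Module.End k (A × A ⊗[k] A) :=
  LinearMap.inl k A (A ⊗[k] A) ∘ₗ LinearMap.mul' k A ∘ₗ LinearMap.snd k A (A ⊗[k] A)

variable {k A}

lemma commute_rightTensor_leftTensor (f g : Module.End k A) :
    Commute (rightTensor k A f) (leftTensor k A g) := by
  change LinearMap.rTensor A f ∘ₗ LinearMap.lTensor A g =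
    LinearMap.lTensor A g ∘ₗ LinearMap.rTensor A f
  rw [LinearMap.rTensor_comp_lTensor, LinearMap.lTensor_comp_rTensor]

variable {σ : Type*}

/-- The series `α ⊗ α` acting on `A ⊗ A`. -/
noncomputable def tensorSquare (α : MvPowerSeries σ (Module.End k A)) :
    MvPowerSeries σ (Module.End k (A ⊗[k] A)) :=
  MvPowerSeries.map (rightTensor k A : Module.End k A →+* _) α *
    MvPowerSeries.map (leftTensor k A : Module.End k A →+* _) α

/-- The series `α ⊕ (α ⊗ α)` acting on `A × (A ⊗ A)`. -/
noncomputable def diag (α : MvPowerSeries σ (Module.End k A)) :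
    MvPowerSeries σ (Module.End k (A × A ⊗[k] A)) :=
  fun d => LinearMap.prodMapAlgHom k A (A ⊗[k] A)
    (MvPowerSeries.coeff d α, MvPowerSeries.coeff d (tensorSquare α))

/-- The failure of a series of endomorphisms to be multiplicative. -/
noncomputable def defect (α : MvPowerSeries σ (Module.End k A)) :
    MvPowerSeries σ (Module.End k (A × A ⊗[k] A)) :=
  diag α * MvPowerSeries.C (mulEnd k A) - MvPowerSeries.C (mulEnd k A) * diag α

lemma coeff_diag (α : MvPowerSeries σ (Module.End k A)) (d : σ →₀ ℕ) :
    MvPowerSeries.coeff d (diag α) = LinearMap.prodMapAlgHom k A (A ⊗[k] A)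
      (MvPowerSeries.coeff d α, MvPowerSeries.coeff d (tensorSquare α)) := rfl

lemma coeff_defect (α : MvPowerSeries σ (Module.End k A)) (d : σ →₀ ℕ) :
    MvPowerSeries.coeff d (defect α) = MvPowerSeries.coeff d (diag α) * mulEnd k A -
      mulEnd k A * MvPowerSeries.coeff d (diag α) := by
  simp [defect]

lemma coeff_tensorSquare (α : MvPowerSeries σ (Module.End k A)) (d : σ →₀ ℕ) [DecidableEq σ] :
    MvPowerSeries.coeff d (tensorSquare α) = ∑ x ∈ antidiagonal d,
      rightTensor k A (MvPowerSeries.coeff x.1 α) *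
        leftTensor k A (MvPowerSeries.coeff x.2 α) := by
  simp [tensorSquare, MvPowerSeries.coeff_mul]

lemma tensorSquare_one : tensorSquare (1 : MvPowerSeries σ (Module.End k A)) = 1 := by
  simp [tensorSquare]

lemma tensorSquare_mul (α β : MvPowerSeries σ (Module.End k A)) :
    tensorSquare (α * β) = tensorSquare α * tensorSquare β := by
  classical
  have h : Commute
      (MvPowerSeries.map (rightTensor k A : Module.End k A →+* Module.End k (A ⊗[k] A)) β)
      (MvPowerSeries.map (leftTensor k A : Module.End k A →+* Module.End k (A ⊗[k] A)) α) := by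
    refine MvPowerSeries.ext fun d => ?_
    rw [MvPowerSeries.coeff_mul, MvPowerSeries.coeff_mul]
    conv_rhs => rw [← HasAntidiagonal.map_swap_antidiagonal, sum_map]
    refine sum_congr rfl fun x _ => ?_
    simpa using (commute_rightTensor_leftTensor _ _).eq
  rw [tensorSquare, tensorSquare, tensorSquare, map_mul, map_mul, mul_assoc, mul_assoc,
    ← mul_assoc (MvPowerSeries.map _ β), h.eq, mul_assoc]

lemma diag_one : diag (1 : MvPowerSeries σ (Module.End k A)) = 1 := by
  classical
  ext1 d
  rw [coeff_diag, tensorSquare_one, MvPowerSeries.coeff_one, MvPowerSeries.coeff_one,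
    MvPowerSeries.coeff_one]
  split_ifs
  · exact map_one _
  · exact map_zero _

lemma diag_mul (α β : MvPowerSeries σ (Module.End k A)) : diag (α * β) = diag α * diag β := by
  classical
  ext1 d
  rw [coeff_diag, tensorSquare_mul, MvPowerSeries.coeff_mul, MvPowerSeries.coeff_mul,
    MvPowerSeries.coeff_mul]
  simp only [coeff_diag, ← map_mul, ← map_sum, Prod.mk_mul_mk]
  congr 1
  ext1 <;> simp [Prod.fst_sum, Prod.snd_sum]

lemma coeff_zero_diag {α : MvPowerSeries σ (Module.End k A)} (h : MvPowerSeries.coeff 0 α = 1) :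
    MvPowerSeries.coeff 0 (diag α) = 1 := by
  classical
  rw [coeff_diag, coeff_tensorSquare]
  simp only [HasAntidiagonal.antidiagonal_zero, sum_singleton, h, map_one, mul_one]
  exact map_one _

lemma defect_one : defect (1 : MvPowerSeries σ (Module.End k A)) = 0 := by
  simp [defect, diag_one]

lemma defect_mul (α β : MvPowerSeries σ (Module.End k A)) :
    defect (α * β) = defect α * diag β + diag α * defect β := by
  simp only [defect, diag_mul, sub_mul, mul_sub, mul_assoc]
  abel

lemma coeff_defect_eq_zero_iff [DecidableEq σ] (α : MvPowerSeries σ (Module.End k A))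
    (d : σ →₀ ℕ) :
    MvPowerSeries.coeff d (defect α) = 0 ↔ ∀ x y : A, MvPowerSeries.coeff d α (x * y) =
      ∑ z ∈ antidiagonal d, MvPowerSeries.coeff z.1 α x * MvPowerSeries.coeff z.2 α y := by
  have key (z : A × A ⊗[k] A) : MvPowerSeries.coeff d (defect α) z =
      (MvPowerSeries.coeff d α (LinearMap.mul' k A z.2) -
        LinearMap.mul' k A (MvPowerSeries.coeff d (tensorSquare α) z.2), 0) := by
    rw [coeff_defect, coeff_diag]
    exact Prod.ext rfl (by simp [mulEnd])
  have tmul (x y : A) : LinearMap.mul' k A (MvPowerSeries.coeff d (tensorSquare α) (x ⊗ₜ y)) =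
      ∑ z ∈ antidiagonal d, MvPowerSeries.coeff z.1 α x * MvPowerSeries.coeff z.2 α y := by
    rw [coeff_tensorSquare, LinearMap.sum_apply, map_sum]
    rfl
  constructor
  · intro h x y
    have := congrArg Prod.fst (key (0, x ⊗ₜ y))
    rw [h, tmul, LinearMap.mul'_apply] at this
    exact sub_eq_zero.1 this.symm
  · intro h
    have : MvPowerSeries.coeff d α ∘ₗ LinearMap.mul' k A =
        LinearMap.mul' k A ∘ₗ MvPowerSeries.coeff d (tensorSquare α) :=
      TensorProduct.ext' fun x y => by
        rw [LinearMap.comp_apply, LinearMap.comp_apply, tmul, LinearMap.mul'_apply, h]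
    refine LinearMap.ext fun z => ?_
    exact (key z).trans (Prod.ext (sub_eq_zero.2 (LinearMap.congr_fun this z.2)) rfl)

/-- The coboundary of a linear endomorphism of `A`. -/
noncomputable def coboundary : Module.End k A →ₗ[k] Module.End k (A × A ⊗[k] A) :=
  let ι := (LinearMap.prodMapAlgHom k A (A ⊗[k] A)).toLinearMap ∘ₗ
    LinearMap.prod LinearMap.id ((rightTensor k A).toLinearMap + (leftTensor k A).toLinearMap)
  (LinearMap.mulRight k (mulEnd k A) - LinearMap.mulLeft k (mulEnd k A)) ∘ₗ ι

lemma coeff_defect_sub {α β : MvPowerSeries σ (Module.End k A)}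
    (hα : MvPowerSeries.coeff 0 α = 1) {d : σ →₀ ℕ} (hd : d ≠ 0)
    (h : ∀ e < d, MvPowerSeries.coeff e α = MvPowerSeries.coeff e β) :
    MvPowerSeries.coeff d (defect α) - MvPowerSeries.coeff d (defect β) =
      coboundary (MvPowerSeries.coeff d α - MvPowerSeries.coeff d β) := by
  classical
  have hβ : MvPowerSeries.coeff 0 β = 1 := by rw [← h 0 (pos_iff_ne_zero.2 hd), hα]
  have hT : MvPowerSeries.coeff d (tensorSquare α) - MvPowerSeries.coeff d (tensorSquare β) =
      rightTensor k A (MvPowerSeries.coeff d α - MvPowerSeries.coeff d β) +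
        leftTensor k A (MvPowerSeries.coeff d α - MvPowerSeries.coeff d β) := by
    rw [coeff_tensorSquare, coeff_tensorSquare, ← sum_sub_distrib,
      ← sum_subset (s₁ := {(d, 0), (0, d)}), sum_pair]
    · simp [hα, hβ]
    · simp [hd]
    · intro x hx
      simp only [mem_insert, mem_singleton] at hx
      rcases hx with rfl | rfl <;> simp
    · rintro ⟨a, b⟩ hx hx'
      rw [HasAntidiagonal.mem_antidiagonal] at hx
      simp only at hx
      subst hx
      simp only [mem_insert, mem_singleton, Prod.mk.injEq, not_or] at hx'
      rw [h a, h b, sub_self]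
      · refine lt_of_le_of_ne le_add_self fun hb => hx'.2 ?_
        have : a = 0 := by simpa using hb
        simp [this]
      · refine lt_of_le_of_ne le_self_add fun hb => hx'.1 ?_
        have : b = 0 := by simpa using hb
        simp [this]
  have hD : MvPowerSeries.coeff d (diag α) - MvPowerSeries.coeff d (diag β) =
      LinearMap.prodMapAlgHom k A (A ⊗[k] A)
        (MvPowerSeries.coeff d α - MvPowerSeries.coeff d β,
          rightTensor k A (MvPowerSeries.coeff d α - MvPowerSeries.coeff d β) +
          leftTensor k A (MvPowerSeries.coeff d α - MvPowerSeries.coeff d β)) := by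
    rw [← hT, coeff_diag, coeff_diag, ← map_sub, Prod.mk_sub_mk]
  rw [coeff_defect, coeff_defect, sub_sub_sub_comm, ← sub_mul, ← mul_sub, hD]
  rfl

lemma coeff_zero_defect {α : MvPowerSeries σ (Module.End k A)}
    (h : MvPowerSeries.coeff 0 α = 1) : MvPowerSeries.coeff 0 (defect α) = 0 := by
  rw [coeff_defect, coeff_zero_diag h, one_mul, mul_one, sub_self]

lemma coeff_defect_congr {α β : MvPowerSeries σ (Module.End k A)}
    (hα : MvPowerSeries.coeff 0 α = 1) {d : σ →₀ ℕ}
    (h : ∀ e ≤ d, MvPowerSeries.coeff e α = MvPowerSeries.coeff e β) :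
    MvPowerSeries.coeff d (defect α) = MvPowerSeries.coeff d (defect β) := by
  rcases eq_or_ne d 0 with rfl | hd
  · rw [coeff_zero_defect hα, coeff_zero_defect (by rw [← h 0 le_rfl, hα])]
  · rw [← sub_eq_zero, coeff_defect_sub hα hd fun e he => h e he.le, h d le_rfl, sub_self, map_zero]

lemma coeff_defect_mul {α β : MvPowerSeries σ (Module.End k A)}
    (hα : MvPowerSeries.coeff 0 α = 1) (hβ : MvPowerSeries.coeff 0 β = 1) {d : σ →₀ ℕ}
    (hα' : ∀ e < d, MvPowerSeries.coeff e (defect α) = 0)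
    (hβ' : ∀ e < d, MvPowerSeries.coeff e (defect β) = 0) :
    MvPowerSeries.coeff d (defect (α * β)) =
      MvPowerSeries.coeff d (defect α) + MvPowerSeries.coeff d (defect β) := by
  classical
  rw [defect_mul, map_add, MvPowerSeries.coeff_mul, MvPowerSeries.coeff_mul,
    sum_eq_single (d, 0), sum_eq_single (0, d)]
  · rw [coeff_zero_diag hα, coeff_zero_diag hβ, mul_one, one_mul]
  · rintro ⟨a, b⟩ hx hx'
    rw [HasAntidiagonal.mem_antidiagonal] at hx
    simp only at hx
    subst hx
    rw [hβ' b, mul_zero]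
    refine lt_of_le_of_ne le_add_self fun hb => hx' ?_
    have : a = 0 := by simpa using hb
    simp [this]
  · intro hx; simp at hx
  · rintro ⟨a, b⟩ hx hx'
    rw [HasAntidiagonal.mem_antidiagonal] at hx
    simp only at hx
    subst hx
    rw [hα' a, zero_mul]
    refine lt_of_le_of_ne le_self_add fun hb => hx' ?_
    have : b = 0 := by simpa using hb
    simp [this]
  · intro hx; simp at hx

lemma defect_subst {φ : MvPowerSeries σ k} (hφ : MvPowerSeries.constantCoeff φ = 0)
    (γ : PowerSeries (Module.End k A)) : defect (subst φ γ) = subst φ (defect γ) := by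
  have hT : tensorSquare (subst φ γ) = subst φ (tensorSquare γ) := by
    rw [tensorSquare, tensorSquare, ← map_subst, ← map_subst, ← subst_mul hφ]
    rfl
  ext1 d
  rw [coeff_defect, coeff_diag, hT, coeff_subst, coeff_subst, coeff_subst]
  have (n : ℕ) : PowerSeries.coeff n (defect γ) =
      LinearMap.prodMapAlgHom k A (A ⊗[k] A)
        (PowerSeries.coeff n γ, PowerSeries.coeff n (tensorSquare γ)) * mulEnd k A -
      mulEnd k A * LinearMap.prodMapAlgHom k A (A ⊗[k] A)
        (PowerSeries.coeff n γ, PowerSeries.coeff n (tensorSquare γ)) := coeff_defect γ _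
  have hsum : (LinearMap.prodMapAlgHom k A (A ⊗[k] A))
      (∑ n ∈ range (d.degree + 1), MvPowerSeries.coeff d (φ ^ n) • PowerSeries.coeff n γ,
        ∑ n ∈ range (d.degree + 1),
          MvPowerSeries.coeff d (φ ^ n) • PowerSeries.coeff n (tensorSquare γ)) =
      ∑ n ∈ range (d.degree + 1), MvPowerSeries.coeff d (φ ^ n) •
        LinearMap.prodMapAlgHom k A (A ⊗[k] A)
          (PowerSeries.coeff n γ, PowerSeries.coeff n (tensorSquare γ)) := by
    simp only [← map_smul, ← map_sum, Prod.smul_mk]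
    congr 1
    ext1 <;> simp [Prod.fst_sum, Prod.snd_sum]
  simp only [this, hsum, smul_sub, sum_sub_distrib, sum_mul, mul_sum, smul_mul_assoc,
    mul_smul_comm]

end Defect

section Series

variable {k A : Type*} [CommRing k] [Ring A] [Algebra k A] {σ : Type*}

lemma coeff_defect_of_forall_eq_zero {α : MvPowerSeries σ (Module.End k A)}
    (hα : MvPowerSeries.coeff 0 α = 1) {d : σ →₀ ℕ} (hd : d ≠ 0)
    (h : ∀ e < d, e ≠ 0 → MvPowerSeries.coeff e α = 0) :
    MvPowerSeries.coeff d (defect α) = coboundary (MvPowerSeries.coeff d α) := by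
  classical
  have := coeff_defect_sub (β := 1) hα hd fun e he => by
    rw [MvPowerSeries.coeff_one]
    split_ifs with h0
    · rw [h0, hα]
    · exact h e he h0
  simpa [defect_one, MvPowerSeries.coeff_one, hd] using this

variable {R : Type*} [Ring R]

lemma exists_mul_eq {β : MvPowerSeries σ R} (hβ : MvPowerSeries.coeff 0 β = 1)
    {α : MvPowerSeries σ R} (hα : MvPowerSeries.coeff 0 α = 1) :
    ∃ δ : MvPowerSeries σ R, δ * β = α ∧ MvPowerSeries.coeff 0 δ = 1 := by
  have h : MvPowerSeries.invOfUnit β 1 * β = 1 :=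
    MvPowerSeries.invOfUnit_mul β 1 (by simpa using hβ)
  have hδ : α * MvPowerSeries.invOfUnit β 1 * β = α := by rw [mul_assoc, h, mul_one]
  refine ⟨_, hδ, ?_⟩
  rw [MvPowerSeries.coeff_zero_eq_constantCoeff] at *
  simp [hα]

lemma coeff_eq_zero_of_mul_eq {α β δ : MvPowerSeries σ R} (hδ : MvPowerSeries.coeff 0 δ = 1)
    (hβ : MvPowerSeries.coeff 0 β = 1) (h : δ * β = α) {d : σ →₀ ℕ}
    (hd : ∀ e ≤ d, MvPowerSeries.coeff e α = MvPowerSeries.coeff e β) (h0 : d ≠ 0) :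
    MvPowerSeries.coeff d δ = 0 := by
  classical
  induction d using WellFoundedLT.induction with
  | ind d ih =>
    have hs := hd d le_rfl
    rw [← h, MvPowerSeries.coeff_mul, ← sum_subset (s₁ := {(d, 0), (0, d)}), sum_pair] at hs
    · simpa [hδ, hβ] using hs
    · simp [h0]
    · intro x hx
      simp only [mem_insert, mem_singleton] at hx
      rcases hx with rfl | rfl <;> simp
    · rintro ⟨a, b⟩ hx hx'
      rw [HasAntidiagonal.mem_antidiagonal] at hx
      simp only at hx
      subst hx
      simp only [mem_insert, mem_singleton, Prod.mk.injEq, not_or] at hx'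
      rw [ih a _ (fun e he => hd e (he.trans le_self_add)), zero_mul]
      · rintro rfl
        simp at hx'
      · refine lt_of_le_of_ne le_self_add fun hb => hx'.1 ?_
        have : b = 0 := by simpa using hb
        simp [this]

lemma coeff_defect_eq_zero_of_mul_eq {α β δ : MvPowerSeries σ (Module.End k A)}
    (hδ : MvPowerSeries.coeff 0 δ = 1) (hβ : MvPowerSeries.coeff 0 β = 1) (h : δ * β = α)
    {d : σ →₀ ℕ} (hα' : ∀ e ≤ d, MvPowerSeries.coeff e (defect α) = 0)
    (hβ' : ∀ e ≤ d, MvPowerSeries.coeff e (defect β) = 0) :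
    MvPowerSeries.coeff d (defect δ) = 0 := by
  induction d using WellFoundedLT.induction with
  | ind d ih =>
    have := coeff_defect_mul hδ hβ (d := d) (fun e he => ih e he
      (fun e' he' => hα' e' (he'.trans he.le)) (fun e' he' => hβ' e' (he'.trans he.le)))
      (fun e he => hβ' e he.le)
    rw [h, hα' d le_rfl, hβ' d le_rfl, add_zero] at this
    exact this.symm

lemma constantCoeff_monomial {w : σ →₀ ℕ} (hw : w ≠ 0) :
    MvPowerSeries.constantCoeff (MvPowerSeries.monomial w (1 : k)) = 0 := by
  rw [← MvPowerSeries.coeff_zero_eq_constantCoeff_apply, MvPowerSeries.coeff_monomial_ne hw.symm]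

end Series

section Jets

variable {k A : Type*} [CommRing k] [Ring A] [Algebra k A]

/-- A power series of endomorphisms which is multiplicative modulo `Xⁿ`. -/
def IsJet (n : ℕ) (γ : PowerSeries (Module.End k A)) : Prop :=
  PowerSeries.coeff 0 γ = 1 ∧ ∀ i < n, PowerSeries.coeff i (defect γ) = 0

lemma exists_single_of_lt {d : Unit →₀ ℕ} {n : ℕ} (h : d < Finsupp.single () n) :
    ∃ i < n, Finsupp.single () i = d := by
  have hd : Finsupp.single () (d ()) = d := by ext; simp
  refine ⟨d (), ?_, hd⟩
  rw [← hd] at h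
  refine lt_of_le_of_ne (by simpa using h.le ()) fun h' => h.ne (by rw [h'])

lemma coeff_zero_powerSeries {R : Type*} [Ring R] (γ : PowerSeries R) :
    PowerSeries.coeff 0 γ = MvPowerSeries.coeff 0 γ := by
  rw [PowerSeries.coeff, Finsupp.single_zero]

lemma IsJet.coeff_zero {n : ℕ} {γ : PowerSeries (Module.End k A)} (h : IsJet n γ) :
    MvPowerSeries.coeff 0 γ = 1 := by
  rw [← coeff_zero_powerSeries, h.1]

lemma IsJet.coeff_eq_zero {n : ℕ} {γ : PowerSeries (Module.End k A)} (h : IsJet n γ)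
    {d : Unit →₀ ℕ} (hd : d < Finsupp.single () n) : MvPowerSeries.coeff d (defect γ) = 0 := by
  obtain ⟨i, hi, rfl⟩ := exists_single_of_lt hd
  exact h.2 i hi

lemma IsJet.mono {m n : ℕ} {γ : PowerSeries (Module.End k A)} (h : IsJet n γ) (hmn : m ≤ n) :
    IsJet m γ := ⟨h.1, fun i hi => h.2 i (hi.trans_le hmn)⟩

lemma IsJet.succ {n : ℕ} {γ : PowerSeries (Module.End k A)} (h : IsJet n γ)
    (h' : PowerSeries.coeff n (defect γ) = 0) : IsJet (n + 1) γ :=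
  ⟨h.1, fun i hi => (Nat.lt_succ_iff_lt_or_eq.1 hi).elim (h.2 i) fun e => e ▸ h'⟩

lemma single_lt_single {i n : ℕ} (h : i < n) :
    (Finsupp.single () i : Unit →₀ ℕ) < Finsupp.single () n := by
  refine lt_of_le_of_ne (Finsupp.single_mono h.le) fun h' => h.ne ?_
  exact Finsupp.single_injective _ h'

lemma isJet_one (n : ℕ) : IsJet n (1 : PowerSeries (Module.End k A)) :=
  ⟨by simp, fun i _ => by rw [defect_one, map_zero]⟩

lemma IsJet.coeff_mul {n : ℕ} {γ γ' : PowerSeries (Module.End k A)} (h : IsJet n γ)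
    (h' : IsJet n γ') : PowerSeries.coeff n (defect (γ * γ')) =
      PowerSeries.coeff n (defect γ) + PowerSeries.coeff n (defect γ') :=
  coeff_defect_mul h.coeff_zero h'.coeff_zero (fun _ he => h.coeff_eq_zero he)
    fun _ he => h'.coeff_eq_zero he

lemma IsJet.mul {n : ℕ} {γ γ' : PowerSeries (Module.End k A)} (h : IsJet n γ)
    (h' : IsJet n γ') : IsJet n (γ * γ') := by
  refine ⟨by simp [PowerSeries.coeff_mul, h.1, h'.1], fun i hi => ?_⟩
  rw [(h.mono hi.le).coeff_mul (h'.mono hi.le), h.2 i hi, h'.2 i hi, add_zero]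

lemma IsJet.exists_mul_eq {n : ℕ} {γ γ' : PowerSeries (Module.End k A)} (h : IsJet n γ)
    (h' : IsJet n γ') : ∃ δ, δ * γ' = γ ∧ IsJet n δ := by
  obtain ⟨δ, hδ, hδ0⟩ := HasseSchmidt.exists_mul_eq h'.coeff_zero h.coeff_zero
  refine ⟨δ, hδ, by rw [coeff_zero_powerSeries, hδ0], fun i hi => ?_⟩
  exact coeff_defect_eq_zero_of_mul_eq hδ0 h'.coeff_zero hδ
    (fun e he => h.coeff_eq_zero (he.trans_lt (single_lt_single hi)))
    fun e he => h'.coeff_eq_zero (he.trans_lt (single_lt_single hi))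

lemma coeff_one_mul' {R : Type*} [Ring R] {γ γ' : PowerSeries R} (h : PowerSeries.coeff 0 γ = 1)
    (h' : PowerSeries.coeff 0 γ' = 1) :
    PowerSeries.coeff 1 (γ * γ') = PowerSeries.coeff 1 γ + PowerSeries.coeff 1 γ' := by
  rw [PowerSeries.coeff_mul, Nat.antidiagonal_succ]
  simp [-PowerSeries.coeff_zero_eq_constantCoeff, h, h', add_comm]

lemma IsJet.coeff_defect_subst {σ : Type*} {n : ℕ} {γ : PowerSeries (Module.End k A)}
    (h : IsJet n γ) {w e : σ →₀ ℕ} (hw : w ≠ 0) (hn : ∀ c, c • w = e → c < n) :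
    MvPowerSeries.coeff e (defect (subst (MvPowerSeries.monomial w (1 : k)) γ)) = 0 := by
  rw [defect_subst (constantCoeff_monomial hw)]
  by_cases he : ∃ c : ℕ, c • w = e
  · obtain ⟨c, rfl⟩ := he
    rw [coeff_subst_monomial_smul hw, h.2 c (hn c rfl)]
  · push Not at he
    exact coeff_subst_monomial_of_forall_ne he _

lemma coeff_defect_subst_smul {σ : Type*} (γ : PowerSeries (Module.End k A)) {w : σ →₀ ℕ}
    (hw : w ≠ 0) (c : ℕ) :
    MvPowerSeries.coeff (c • w) (defect (subst (MvPowerSeries.monomial w (1 : k)) γ)) =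
      PowerSeries.coeff c (defect γ) := by
  rw [defect_subst (constantCoeff_monomial hw), coeff_subst_monomial_smul hw]

/-- The reparametrisation `γ(X) ↦ γ(Xᵉ)`. -/
noncomputable def expand (e : ℕ) (γ : PowerSeries (Module.End k A)) :
    PowerSeries (Module.End k A) :=
  subst (MvPowerSeries.monomial (Finsupp.single () e) (1 : k)) γ

lemma coeff_expand {e : ℕ} (he : e ≠ 0) (γ : PowerSeries (Module.End k A)) (c : ℕ) :
    PowerSeries.coeff (c * e) (expand e γ) = PowerSeries.coeff c γ := by
  have := coeff_subst_monomial_smul (k := k) (w := Finsupp.single () e) (by simpa using he) γ c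
  rwa [Finsupp.smul_single, smul_eq_mul] at this

lemma coeff_expand_of_not_dvd {e i : ℕ} (h : ¬ e ∣ i) (γ : PowerSeries (Module.End k A)) :
    PowerSeries.coeff i (expand e γ) = 0 := by
  refine coeff_subst_monomial_of_forall_ne (fun c hc => h ⟨c, ?_⟩) γ
  rw [Finsupp.smul_single, smul_eq_mul] at hc
  rw [mul_comm, Finsupp.single_injective _ hc]

lemma coeff_defect_expand {e : ℕ} (he : e ≠ 0) (γ : PowerSeries (Module.End k A)) (c : ℕ) :
    PowerSeries.coeff (c * e) (defect (expand e γ)) = PowerSeries.coeff c (defect γ) := by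
  have := coeff_defect_subst_smul γ (w := Finsupp.single () e) (by simpa using he) c
  rwa [Finsupp.smul_single, smul_eq_mul] at this

lemma IsJet.expand {n m e : ℕ} {γ : PowerSeries (Module.End k A)} (h : IsJet n γ) (he : e ≠ 0)
    (hm : m ≤ n * e) : IsJet m (expand e γ) := by
  refine ⟨?_, fun i hi => ?_⟩
  · have := coeff_expand he γ 0
    rwa [zero_mul, h.1] at this
  · refine h.coeff_defect_subst (by simpa using he) fun c hc => ?_
    rw [Finsupp.smul_single, smul_eq_mul] at hc
    have := Finsupp.single_injective _ hc
    exact lt_of_mul_lt_mul_right (this.trans_lt (hi.trans_le hm)) (Nat.zero_le e)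

variable (k A) in
/-- The obstructions to extending, past order `n`, the series which are multiplicative modulo
`Xⁿ` and congruent to the identity modulo `Xᵐ`. -/
def obstruction (m n : ℕ) : AddSubgroup (Module.End k (A × A ⊗[k] A)) where
  carrier := {x | ∃ γ : PowerSeries (Module.End k A), IsJet n γ ∧
    (∀ i, 0 < i → i < m → PowerSeries.coeff i γ = 0) ∧ PowerSeries.coeff n (defect γ) = x}
  zero_mem' := ⟨1, isJet_one n, fun i hi _ => by simp [PowerSeries.coeff_one, hi.ne'],
    by rw [defect_one, map_zero]⟩
  add_mem' := by
    rintro _ _ ⟨γ, h, hm, rfl⟩ ⟨γ', h', hm', rfl⟩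
    refine ⟨γ * γ', h.mul h', fun i hi him => ?_, h.coeff_mul h'⟩
    rw [PowerSeries.coeff_mul]
    refine sum_eq_zero fun x hx => ?_
    rw [HasAntidiagonal.mem_antidiagonal] at hx
    rcases Nat.eq_zero_or_pos x.1 with h0 | h0
    · rw [hm' x.2 (by omega) (by omega), mul_zero]
    · rw [hm x.1 h0 (by omega), zero_mul]
  neg_mem' := by
    rintro _ ⟨γ, h, hm, rfl⟩
    obtain ⟨δ, hδ, hδ'⟩ := (isJet_one n).exists_mul_eq h
    refine ⟨δ, hδ', fun i hi him => ?_, ?_⟩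
    · refine coeff_eq_zero_of_mul_eq hδ'.coeff_zero h.coeff_zero hδ
        (d := Finsupp.single () i) (fun e he => ?_) (by simpa using hi.ne')
      obtain ⟨j, hj, rfl⟩ := exists_single_of_lt (he.trans_lt (single_lt_single him))
      change PowerSeries.coeff j _ = PowerSeries.coeff j γ
      rcases Nat.eq_zero_or_pos j with rfl | h0
      · rw [h.1]; simp
      · rw [hm j h0 hj, PowerSeries.coeff_one, if_neg h0.ne']
    · have := hδ'.coeff_mul h
      rw [hδ, defect_one, map_zero] at this
      exact eq_neg_of_add_eq_zero_left this.symm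

lemma IsJet.mem_obstruction {n : ℕ} {γ : PowerSeries (Module.End k A)} (h : IsJet n γ) :
    PowerSeries.coeff n (defect γ) ∈ obstruction k A 1 n :=
  ⟨γ, h, fun i hi hi' => by omega, rfl⟩

lemma coboundary_mem_obstruction (b : Module.End k A) : coboundary b ∈ obstruction k A 1 1 := by
  let γ : PowerSeries (Module.End k A) := 1 + PowerSeries.monomial 1 b
  have h0 : PowerSeries.coeff 0 γ = 1 := by
    rw [map_add, PowerSeries.coeff_zero_one, PowerSeries.coeff_monomial, if_neg zero_ne_one,
      add_zero]
  have h1 : PowerSeries.coeff 1 γ = b := by simp [γ, PowerSeries.coeff_one]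
  have hγ : IsJet 1 γ := by
    refine ⟨h0, fun i hi => ?_⟩
    obtain rfl : i = 0 := by omega
    rw [coeff_zero_powerSeries] at h0 ⊢
    exact coeff_zero_defect h0
  have := coeff_defect_of_forall_eq_zero hγ.coeff_zero (d := Finsupp.single () 1) (by simp)
    fun e he he0 => by
      obtain ⟨i, hi, rfl⟩ := exists_single_of_lt he
      obtain rfl : i = 0 := by omega
      simp at he0
  have hmem := hγ.mem_obstruction
  rw [← h1]
  rwa [show PowerSeries.coeff 1 (defect γ) = _ from this] at hmem

lemma obstruction_le_mul {n e : ℕ} (he : e ≠ 0) :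
    obstruction k A 1 n ≤ obstruction k A e (n * e) := by
  rintro _ ⟨γ, h, -, rfl⟩
  refine ⟨expand e γ, h.expand he le_rfl, fun i hi hi' => ?_, coeff_defect_expand he γ n⟩
  exact coeff_expand_of_not_dvd (Nat.not_dvd_of_pos_of_lt hi hi') γ

lemma obstruction_anti {m m' n : ℕ} (h : m ≤ m') :
    obstruction k A m' n ≤ obstruction k A m n := by
  rintro _ ⟨γ, hγ, h', rfl⟩
  exact ⟨γ, hγ, fun i hi hi' => h' i hi (hi'.trans_le h), rfl⟩

variable (k A) in
/-- The linear coefficients of the series which are multiplicative modulo `Xⁿ`. -/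
def leading (n : ℕ) : Submodule k (Module.End k A) where
  carrier := {D | ∃ γ : PowerSeries (Module.End k A), IsJet n γ ∧ PowerSeries.coeff 1 γ = D}
  zero_mem' := ⟨1, isJet_one n, by simp [PowerSeries.coeff_one]⟩
  add_mem' := by
    rintro _ _ ⟨γ, h, rfl⟩ ⟨γ', h', rfl⟩
    exact ⟨γ * γ', h.mul h', coeff_one_mul' h.1 h'.1⟩
  smul_mem' := by
    rintro c _ ⟨γ, h, rfl⟩
    have hc : MvPowerSeries.constantCoeff (MvPowerSeries.monomial (Finsupp.single () 1) c) = 0 := by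
      rw [← MvPowerSeries.coeff_zero_eq_constantCoeff_apply,
        MvPowerSeries.coeff_monomial_ne (Finsupp.single_ne_zero.2 one_ne_zero).symm]
    have key {R : Type _} [Ring R] [Algebra k R] (f : PowerSeries R) (i : ℕ) :
        PowerSeries.coeff i (subst (MvPowerSeries.monomial (Finsupp.single () 1) c) f :
          PowerSeries R) = c ^ i • PowerSeries.coeff i f := by
      rw [PowerSeries.coeff, coeff_subst, sum_eq_single i]
      · simp [MvPowerSeries.monomial_pow, PowerSeries.coeff]
      · intro n _ hn
        rw [MvPowerSeries.monomial_pow, MvPowerSeries.coeff_monomial_ne, zero_smul]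
        simpa using hn.symm
      · simp
    refine ⟨subst (MvPowerSeries.monomial (Finsupp.single () 1) c) γ, ⟨?_, fun i hi => ?_⟩, ?_⟩
    · rw [key, h.1, pow_zero, one_smul]
    · rw [defect_subst hc, key, h.2 i hi, smul_zero]
    · rw [key, pow_one]

lemma leading_anti : Antitone (leading k A) := by
  rintro m n h _ ⟨γ, hγ, rfl⟩
  exact ⟨γ, hγ.mono h, rfl⟩

lemma IsJet.coeff_one_mem_leading {n : ℕ} {γ : PowerSeries (Module.End k A)} (h : IsJet n γ)
    (h' : PowerSeries.coeff n (defect γ) ∈ obstruction k A 2 n) :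
    PowerSeries.coeff 1 γ ∈ leading k A (n + 1) := by
  obtain ⟨γ', hγ', h1, hn⟩ := h'
  obtain ⟨δ, hδ, hδ'⟩ := h.exists_mul_eq hγ'
  refine ⟨δ, hδ'.succ ?_, ?_⟩
  · have := hδ'.coeff_mul hγ'
    rw [hδ, hn] at this
    exact left_eq_add.1 (this.trans (add_comm _ _))
  · rw [← hδ, coeff_one_mul' hδ'.1 hγ'.1, h1 1 one_pos one_lt_two, add_zero]

end Jets

section Peeling

variable {k A : Type*} [CommRing k] [Ring A] [Algebra k A] {σ : Type*} (ord : MonomialOrder σ)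

variable (k A) in
/-- The leading coefficient, at any exponent `w`, of a multivariate series which is multiplicative
at all divisors of `X^(n w)` is the linear coefficient of a series multiplicative modulo
`X^(n+1)`. -/
def LeadingExtends (n : ℕ) : Prop :=
  ∀ (w : σ →₀ ℕ) (α : MvPowerSeries σ (Module.End k A)), w ≠ 0 → MvPowerSeries.coeff 0 α = 1 →
    (∀ e ≤ n • w, MvPowerSeries.coeff e (defect α) = 0) →
    (∀ e ≤ n • w, e ≠ 0 → ord.toSyn e < ord.toSyn w → MvPowerSeries.coeff e α = 0) →
    MvPowerSeries.coeff w α ∈ leading k A (n + 1)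

lemma le_nsmul_self {w : σ →₀ ℕ} {c : ℕ} (hc : c ≠ 0) : w ≤ c • w := fun i => by
  simpa using Nat.le_mul_of_pos_left (w i) (Nat.pos_of_ne_zero hc)

lemma nsmul_le_nsmul_nat (w : σ →₀ ℕ) {a b : ℕ} (h : a ≤ b) : a • w ≤ b • w := fun i => by
  simpa using Nat.mul_le_mul_right (w i) h

lemma nsmul_lt_nsmul_nat {w : σ →₀ ℕ} (hw : w ≠ 0) {a b : ℕ} (h : a < b) : a • w < b • w :=
  lt_of_le_of_ne (nsmul_le_nsmul_nat w h.le) fun h' => h.ne (nsmul_left_cancel hw h')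

lemma lt_of_nsmul_lt_nsmul {w : σ →₀ ℕ} {a b : ℕ} (h : a • w < b • w) : a < b :=
  lt_of_not_ge fun h' => h.not_ge (nsmul_le_nsmul_nat w h')

lemma exists_max_nsmul_lt {w v : σ →₀ ℕ} (hw : w ≠ 0) (hv : w < v) :
    ∃ m : ℕ, m • w < v ∧ ∀ c : ℕ, c • w < v → c ≤ m := by
  classical
  obtain ⟨i, hi⟩ := Finsupp.ne_iff.1 hw
  have hb (c : ℕ) (hc : c • w < v) : c ≤ v i :=
    (Nat.le_mul_of_pos_right c (Nat.pos_of_ne_zero hi)).trans (by simpa using hc.le i)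
  refine ⟨Nat.findGreatest (fun m => m • w < v) (v i), ?_, fun c hc =>
    Nat.le_findGreatest (hb c hc) hc⟩
  exact Nat.findGreatest_spec (P := fun m => m • w < v) (hb 1 (by simpa)) (by simpa)

/-- If `α` has leading exponent `w` and `γ` extends its leading coefficient, then dividing `α` by
`γ(X^w)` increases the leading exponent. -/
lemma coeff_eq_coeff_subst {α : MvPowerSeries σ (Module.End k A)} {w v : σ →₀ ℕ} (hw : w ≠ 0)
    (hα : MvPowerSeries.coeff 0 α = 1)
    (hz : ∀ e < v, e ≠ 0 → ord.toSyn e < ord.toSyn w → MvPowerSeries.coeff e α = 0)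
    {γ : PowerSeries (Module.End k A)} (hγ : PowerSeries.coeff 0 γ = 1)
    (hγ' : PowerSeries.coeff 1 γ = MvPowerSeries.coeff w α) {e : σ →₀ ℕ} (he : e < v)
    (hew : ord.toSyn e ≤ ord.toSyn w) : MvPowerSeries.coeff e α =
      MvPowerSeries.coeff e (subst (MvPowerSeries.monomial w (1 : k)) γ) := by
  rcases eq_or_ne e 0 with rfl | he0
  · rw [coeff_zero_subst, hγ, hα]
  rcases hew.eq_or_lt with h | h
  · rw [ord.toSyn.injective h, ← hγ']
    simpa using (coeff_subst_monomial_smul (k := k) hw γ 1).symm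
  · rw [hz e he he0 h, coeff_subst_monomial_of_forall_ne]
    rintro c rfl
    refine h.not_ge (ord.toSyn_monotone (le_nsmul_self ?_))
    rintro rfl
    simp at he0

lemma coeff_defect_mem_of_leadingExtends {v : σ →₀ ℕ}
    (K : AddSubgroup (Module.End k (A × A ⊗[k] A))) (w₀ : σ →₀ ℕ)
    (hL : ∀ (m : ℕ) (w : σ →₀ ℕ), ord.toSyn w₀ < ord.toSyn w → m • w < v → LeadingExtends k A ord m)
    (hK : ∀ (c : ℕ) (w : σ →₀ ℕ), ord.toSyn w₀ < ord.toSyn w → c • w = v →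
      obstruction k A 1 c ≤ K)
    (hv : ord.toSyn w₀ < ord.toSyn v) (α : MvPowerSeries σ (Module.End k A))
    (hα : MvPowerSeries.coeff 0 α = 1)
    (hα' : ∀ e < v, MvPowerSeries.coeff e (defect α) = 0)
    (hz : ∀ e < v, e ≠ 0 → ord.toSyn e ≤ ord.toSyn w₀ → MvPowerSeries.coeff e α = 0) :
    MvPowerSeries.coeff v (defect α) ∈ K := by
  classical
  induction hN : #{e ∈ Iio v | ord.toSyn w₀ < ord.toSyn e} using Nat.strong_induction_on
    generalizing w₀ α with
  | _ N ih =>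
    subst hN
    by_cases hne : ∀ e < v, e ≠ 0 → MvPowerSeries.coeff e α = 0
    · rw [coeff_defect_of_forall_eq_zero hα _ hne]
      · exact hK 1 v hv (one_smul _ _) (coboundary_mem_obstruction _)
      · rintro rfl
        rw [map_zero] at hv
        exact absurd (ord.zero_le _) hv.not_ge
    · push Not at hne
      obtain ⟨e₀, he₀, he₀'⟩ := hne
      obtain ⟨w, hwS, hmin⟩ := exists_min_image
        {e ∈ Iio v | e ≠ 0 ∧ MvPowerSeries.coeff e α ≠ 0} ord.toSyn ⟨e₀, by simp [he₀, he₀']⟩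
      simp only [mem_filter, mem_Iio] at hwS hmin
      obtain ⟨hwv, hw, hwα⟩ := hwS
      have hw₀ : ord.toSyn w₀ < ord.toSyn w := lt_of_not_ge fun h => hwα (hz w hwv hw h)
      obtain ⟨m, hm, hmax⟩ := exists_max_nsmul_lt hw hwv
      have hlow : ∀ e < v, e ≠ 0 → ord.toSyn e < ord.toSyn w → MvPowerSeries.coeff e α = 0 :=
        fun e he he0 h => by_contra fun h' => h.not_ge (hmin e ⟨he, he0, h'⟩)
      obtain ⟨γ, hγ, hγ'⟩ := hL m w hw₀ hm w α hw hα (fun e he => hα' e (he.trans_lt hm))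
        fun e he => hlow e (he.trans_lt hm)
      set β := subst (MvPowerSeries.monomial w (1 : k)) γ with hβdef
      have hβ : MvPowerSeries.coeff 0 β = 1 := by rw [coeff_zero_subst, hγ.1]
      have hβ' : ∀ e < v, MvPowerSeries.coeff e (defect β) = 0 := fun e he =>
        hγ.coeff_defect_subst hw fun c hc => Nat.lt_succ_of_le (hmax c (hc ▸ he))
      obtain ⟨δ, hδ, hδ0⟩ := exists_mul_eq hβ hα
      have hδ' : ∀ e < v, MvPowerSeries.coeff e (defect δ) = 0 := fun e he =>
        coeff_defect_eq_zero_of_mul_eq hδ0 hβ hδ (fun e' he' => hα' e' (he'.trans_lt he))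
          fun e' he' => hβ' e' (he'.trans_lt he)
      rw [← hδ, coeff_defect_mul hδ0 hβ hδ' hβ']
      refine K.add_mem ?_ ?_
      · refine ih _ (card_lt_card ?_) w (fun m w' h => hL m w' (hw₀.trans h))
          (fun c w' h => hK c w' (hw₀.trans h)) (ord.toSyn_strictMono hwv) δ hδ0 hδ' ?_ rfl
        · refine ⟨fun e he => ?_, fun h => ?_⟩
          · simp only [mem_filter] at he ⊢
            exact ⟨he.1, hw₀.trans he.2⟩
          · have := h (mem_filter.2 ⟨mem_Iio.2 hwv, hw₀⟩)
            simp at this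
        · intro e he he0 hew
          refine coeff_eq_zero_of_mul_eq hδ0 hβ hδ (fun e' he' => ?_) he0
          exact coeff_eq_coeff_subst ord hw hα hlow hγ.1 hγ' (he'.trans_lt he)
            ((ord.toSyn_monotone he').trans hew)
      · by_cases hc : ∃ c : ℕ, c • w = v
        · obtain ⟨c, rfl⟩ := hc
          rw [hβdef, coeff_defect_subst_smul γ hw]
          refine hK c w hw₀ rfl (IsJet.mem_obstruction ⟨hγ.1, fun i hi => hγ.2 i ?_⟩)
          exact Nat.lt_succ_of_le (hmax i (nsmul_lt_nsmul_nat hw hi))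
        · rw [hβdef, hγ.coeff_defect_subst hw fun c h => absurd ⟨c, h⟩ hc]
          exact K.zero_mem

variable (k A) in
/-- The obstructions of order `n` already occur at the largest power of `p` dividing `n`. -/
def ObstructionReduces (p n : ℕ) : Prop :=
  obstruction k A 1 n ≤ obstruction k A 1 (p ^ n.factorization p)

lemma obstruction_le_of_lt_pow {p : ℕ} (hp : p.Prime) {c a : ℕ} (hc : c ≠ 0) (hca : c < p ^ a)
    (h : ObstructionReduces k A p c) : obstruction k A 1 c ≤ obstruction k A 2 (p ^ a) := by
  have hb : c.factorization p < a :=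
    (Nat.pow_lt_pow_iff_right hp.one_lt).1 ((Nat.ordProj_le p hc).trans_lt hca)
  refine h.trans ((obstruction_le_mul (e := p ^ (a - c.factorization p))
    (pow_ne_zero _ hp.ne_zero)).trans ?_)
  rw [← pow_add, Nat.add_sub_cancel' hb.le]
  exact obstruction_anti (hp.two_le.trans (Nat.le_self_pow (by omega) p))

lemma obstruction_le_of_ne_pow {p n : ℕ} (hn : n ≠ 0) (hne : p ^ n.factorization p ≠ n)
    (h : ObstructionReduces k A p n) : obstruction k A 1 n ≤ obstruction k A 2 n := by
  have hmul : p ^ n.factorization p * (n / p ^ n.factorization p) = n :=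
    Nat.ordProj_mul_ordCompl_eq_self n p
  have h0 : n / p ^ n.factorization p ≠ 0 := fun h0 => hn (by rw [← hmul, h0, mul_zero])
  refine h.trans ((obstruction_le_mul h0).trans ?_)
  rw [hmul]
  refine obstruction_anti ?_
  have h1 : n / p ^ n.factorization p ≠ 1 := fun h1 => hne (by rwa [h1, mul_one] at hmul)
  exact (Nat.two_le_iff _).2 ⟨h0, h1⟩

lemma leadingExtends_of_lt {p : ℕ} (hp : p.Prime) {n : ℕ}
    (hO : ∀ c ≤ n, c ≠ 0 → ObstructionReduces k A p c)
    (hL : ∀ m < n, LeadingExtends k A ord m) : LeadingExtends k A ord n := by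
  intro w α hw hα hα' hz
  rcases n with _ | n
  · refine ⟨1 + PowerSeries.monomial 1 (MvPowerSeries.coeff w α), ⟨?_, fun i hi => ?_⟩, ?_⟩
    · rw [map_add, PowerSeries.coeff_zero_one, PowerSeries.coeff_monomial, if_neg zero_ne_one,
        add_zero]
    · obtain rfl : i = 0 := by omega
      rw [coeff_zero_powerSeries]
      refine coeff_zero_defect ?_
      rw [← coeff_zero_powerSeries, map_add, PowerSeries.coeff_zero_one,
        PowerSeries.coeff_monomial, if_neg zero_ne_one, add_zero]
    · simp [PowerSeries.coeff_one]
  obtain ⟨γ, hγ, hγ'⟩ := hL n (Nat.lt_succ_self n) w α hw hα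
    (fun e he => hα' e (he.trans (nsmul_le_nsmul_nat w n.le_succ)))
    fun e he => hz e (he.trans (nsmul_le_nsmul_nat w n.le_succ))
  rw [← hγ']
  refine hγ.coeff_one_mem_leading ?_
  by_cases hpow : p ^ (n + 1).factorization p = n + 1
  swap
  · exact obstruction_le_of_ne_pow n.succ_ne_zero hpow (hO _ le_rfl n.succ_ne_zero)
      hγ.mem_obstruction
  rcases n with _ | n
  · have h1 : PowerSeries.coeff 1 (defect γ) = coboundary (PowerSeries.coeff 1 γ) := by
      refine coeff_defect_of_forall_eq_zero hγ.coeff_zero (by simp) fun e he he0 => ?_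
      obtain ⟨i, hi, rfl⟩ := exists_single_of_lt he
      obtain rfl : i = 0 := by omega
      simp at he0
    rw [zero_add, h1, hγ', ← coeff_defect_of_forall_eq_zero hα hw fun e he he0 =>
      hz e (by simpa using he.le) he0 (ord.toSyn_strictMono he), hα' w (by simp)]
    exact zero_mem _
  set v := (n + 1 + 1) • w
  set β := subst (MvPowerSeries.monomial w (1 : k)) γ with hβdef
  have hβ : MvPowerSeries.coeff 0 β = 1 := by rw [coeff_zero_subst, hγ.1]
  have hβ' : ∀ e < v, MvPowerSeries.coeff e (defect β) = 0 := fun e he =>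
    hγ.coeff_defect_subst hw fun c hc => lt_of_nsmul_lt_nsmul (hc ▸ he)
  obtain ⟨δ, hδ, hδ0⟩ := exists_mul_eq hβ hα
  have hδ' : ∀ e < v, MvPowerSeries.coeff e (defect δ) = 0 := fun e he =>
    coeff_defect_eq_zero_of_mul_eq hδ0 hβ hδ (fun e' he' => hα' e' (he'.trans he.le))
      fun e' he' => hβ' e' (he'.trans_lt he)
  have hsum := coeff_defect_mul hδ0 hβ hδ' hβ'
  rw [hδ, hα' v le_rfl, hβdef, coeff_defect_subst_smul γ hw] at hsum
  rw [eq_neg_of_add_eq_zero_right hsum.symm]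
  have hlt {c : ℕ} {w' : σ →₀ ℕ} (hw' : ord.toSyn w < ord.toSyn w') (hc : c • w' ≤ v) :
      c < n + 1 + 1 := by
    refine lt_of_not_ge fun h => ?_
    have h1 : ord.toSyn ((n + 1 + 1) • w) < ord.toSyn ((n + 1 + 1) • w') := by
      rw [map_nsmul, map_nsmul]
      exact nsmul_lt_nsmul_right (n + 1).succ_ne_zero hw'
    exact h1.not_ge (ord.toSyn_monotone ((nsmul_le_nsmul_nat w' h).trans hc))
  refine neg_mem (coeff_defect_mem_of_leadingExtends ord _ w
    (fun m w' hw' hm => hL m (hlt hw' hm.le)) (fun c w' hw' hc => ?_) ?_ δ hδ0 hδ' ?_)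
  · have hc0 : c ≠ 0 := by
      rintro rfl
      exact (nsmul_lt_nsmul_nat hw (Nat.succ_pos (n + 1))).ne (by rw [zero_smul] at hc ⊢; exact hc)
    have hcn := hlt hw' hc.le
    rw [← hpow]
    exact obstruction_le_of_lt_pow hp hc0 (hpow.symm ▸ hcn) (hO c hcn.le hc0)
  · refine ord.toSyn_strictMono ?_
    simpa using nsmul_lt_nsmul_nat hw (show 1 < n + 1 + 1 by omega)
  · intro e he he0 hew
    refine coeff_eq_zero_of_mul_eq hδ0 hβ hδ (fun e' he' => ?_) he0
    exact coeff_eq_coeff_subst ord hw hα (fun e he => hz e he.le) hγ.1 hγ' (he'.trans_lt he)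
      ((ord.toSyn_monotone he').trans hew)

end Peeling

section Reduction

variable {k A : Type*} [CommRing k] [Ring A] [Algebra k A]

/-- The generic sum `X₀ + X₁`. -/
noncomputable def sumX (k : Type*) [CommRing k] : MvPowerSeries (Fin 2) k :=
  MvPowerSeries.X 0 + MvPowerSeries.X 1

lemma coeff_sumX_pow {a b : ℕ} (n : ℕ) :
    MvPowerSeries.coeff (Finsupp.single 0 a + Finsupp.single 1 b) (sumX k ^ n) =
      if a + b = n then (n.choose a : k) else 0 := by
  classical
  have hX (i j : ℕ) : (MvPowerSeries.X 0 : MvPowerSeries (Fin 2) k) ^ i *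
      MvPowerSeries.X 1 ^ j * (n.choose i : MvPowerSeries (Fin 2) k) =
        MvPowerSeries.monomial (Finsupp.single 0 i + Finsupp.single 1 j) (n.choose i : k) := by
    rw [MvPowerSeries.X_pow_eq, MvPowerSeries.X_pow_eq, MvPowerSeries.monomial_mul_monomial,
      ← map_natCast (MvPowerSeries.C (σ := Fin 2) (R := k)),
      ← MvPowerSeries.monomial_zero_eq_C_apply, MvPowerSeries.monomial_mul_monomial]
    simp
  have hinj {i j : ℕ} (h : (Finsupp.single 0 a + Finsupp.single 1 b : Fin 2 →₀ ℕ) =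
      Finsupp.single 0 i + Finsupp.single 1 j) : a = i ∧ b = j := by
    have h0 := DFunLike.congr_fun h 0
    have h1 := DFunLike.congr_fun h 1
    simp at h0 h1
    exact ⟨h0, h1⟩
  unfold sumX
  rw [add_pow, map_sum]
  simp only [hX, MvPowerSeries.coeff_monomial]
  split_ifs with hab
  · rw [sum_eq_single a, if_pos (by rw [← hab, Nat.add_sub_cancel_left])]
    · exact fun i _ hi => if_neg fun h => hi (hinj h).1.symm
    · exact fun h => absurd (mem_range.2 (by omega)) h
  · refine sum_eq_zero fun i hi => if_neg fun h => hab ?_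
    have := hinj h
    have := mem_range.1 hi
    omega

lemma choose_pow_modEq {p : ℕ} (hp : p.Prime) (a m : ℕ) :
    (p ^ a * m).choose (p ^ a) ≡ m [MOD p] := by
  have := Fact.mk hp
  induction a with
  | zero => simp [Nat.ModEq]
  | succ a ih =>
    have h := Choose.choose_modEq_choose_mod_mul_choose_div_nat (p := p) (n := p ^ (a + 1) * m)
      (k := p ^ (a + 1))
    rw [pow_succ', mul_assoc, Nat.mul_mod_right, Nat.mul_mod_right, Nat.choose_zero_right, one_mul,
      Nat.mul_div_cancel_left _ hp.pos, Nat.mul_div_cancel_left _ hp.pos] at h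
    rw [pow_succ', mul_assoc]
    exact h.trans ih

lemma mem_of_nsmul_mem {M : Type*} [AddCommGroup M] (K : AddSubgroup M) {p m : ℕ}
    (hpm : p.Coprime m) {x : M} (hx : p • x = 0) (h : m • x ∈ K) : x ∈ K := by
  have hb := Nat.gcd_eq_gcd_ab p m
  rw [hpm.gcd_eq_one, Nat.cast_one] at hb
  have h1 : x = (p.gcdB m) • (m • x) := by
    calc x = (1 : ℤ) • x := (one_smul _ _).symm
      _ = _ := by
        rw [hb, add_smul, mul_comm, mul_smul, natCast_zsmul, hx, smul_zero, zero_add, mul_comm,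
          mul_smul, natCast_zsmul]
  rw [h1]
  exact K.zsmul_mem h _

lemma coeff_subst_sumX {R : Type*} [Ring R] [Algebra k R] (γ : PowerSeries R) (a b : ℕ) :
    MvPowerSeries.coeff (Finsupp.single 0 a + Finsupp.single 1 b) (subst (sumX k) γ) =
      (a + b).choose a • PowerSeries.coeff (a + b) γ := by
  rw [coeff_subst, sum_eq_single (a + b)]
  · rw [coeff_sumX_pow, if_pos rfl, Nat.cast_smul_eq_nsmul]
  · intro i _ hi
    rw [coeff_sumX_pow, if_neg hi.symm, zero_smul]
  · intro h
    exact absurd (mem_range.2 (by simp)) h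

lemma constantCoeff_sumX : MvPowerSeries.constantCoeff (sumX k) = 0 := by simp [sumX]

lemma eq_single_add_single (e : Fin 2 →₀ ℕ) :
    e = Finsupp.single 0 (e 0) + Finsupp.single 1 (e 1) := by
  ext i
  fin_cases i <;> simp

lemma single_add_single_lt {e : Fin 2 →₀ ℕ} {a b : ℕ}
    (h : e < Finsupp.single 0 a + Finsupp.single 1 b) : e 0 ≤ a ∧ e 1 ≤ b ∧ e 0 + e 1 < a + b := by
  have h0 : e 0 ≤ a := by simpa using h.le 0
  have h1 : e 1 ≤ b := by simpa using h.le 1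
  refine ⟨h0, h1, lt_of_not_ge fun h2 => h.ne ?_⟩
  rw [eq_single_add_single e, show e 0 = a by omega, show e 1 = b by omega]

lemma obstructionReduces_of_lt {p : ℕ} (hp : p.Prime) [CharP k p] (ord : MonomialOrder (Fin 2))
    {n : ℕ} (hn : n ≠ 0) (hL : ∀ m < n, LeadingExtends k A ord m) :
    ObstructionReduces k A p n := by
  rw [ObstructionReduces]
  have hmul : p ^ n.factorization p * (n / p ^ n.factorization p) = n :=
    Nat.ordProj_mul_ordCompl_eq_self n p
  have hcop : p.Coprime (n / p ^ n.factorization p) := Nat.coprime_ordCompl hp hn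
  generalize n.factorization p = a at *
  generalize n / p ^ a = m at *
  have hq0 : 0 < p ^ a := pow_pos hp.pos a
  have hm0 : m ≠ 0 := by rintro rfl; simp at hmul; exact hn hmul.symm
  rcases eq_or_ne m 1 with rfl | hm1
  · rw [← hmul, mul_one]
  have hlt : p ^ a < n := by
    rw [← hmul]
    exact lt_mul_of_one_lt_right hq0 (by omega)
  have hsplit : p ^ a + (n - p ^ a) = n := by omega
  rintro _ ⟨γ, hγ, -, rfl⟩
  have hzero (e : Fin 2 →₀ ℕ) (he : e < Finsupp.single 0 (p ^ a) + Finsupp.single 1 (n - p ^ a)) :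
      MvPowerSeries.coeff e (defect (subst (sumX k) γ)) = 0 := by
    have := (single_add_single_lt he).2.2
    rw [defect_subst constantCoeff_sumX, eq_single_add_single e, coeff_subst_sumX,
      hγ.2 _ (by omega), smul_zero]
  have hmem := coeff_defect_mem_of_leadingExtends ord
    (v := Finsupp.single 0 (p ^ a) + Finsupp.single 1 (n - p ^ a)) (obstruction k A 1 (p ^ a)) 0
    (fun c w hw hc => hL c ?_) (fun c w hw hc => ?_) (ord.toSyn_strictMono ?_)
    (subst (sumX k) γ) (by rw [coeff_zero_subst, hγ.1]) hzero
    fun e _ he h => absurd (ord.toSyn.injective (le_antisymm h (by simp))) he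
  · rw [defect_subst constantCoeff_sumX, coeff_subst_sumX, hsplit] at hmem
    refine mem_of_nsmul_mem _ (p := p) ?_ ?_ hmem
    · rw [Nat.coprime_comm, Nat.Coprime, ← hmul, (choose_pow_modEq hp a m).gcd_eq, Nat.gcd_comm]
      exact hcop
    · rw [← Nat.cast_smul_eq_nsmul k, CharP.cast_eq_zero, zero_smul]
  · have hw0 : w ≠ 0 := by rintro rfl; exact hw.false
    obtain ⟨h0, h1, -⟩ := single_add_single_lt hc
    simp only [Finsupp.smul_apply, smul_eq_mul] at h0 h1
    rw [eq_single_add_single w] at hw0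
    by_cases hw0' : w 0 = 0
    · have : w 1 ≠ 0 := by
        intro h; simp [h, hw0'] at hw0
      have := Nat.le_mul_of_pos_right c (Nat.pos_of_ne_zero this)
      omega
    · have := Nat.le_mul_of_pos_right c (Nat.pos_of_ne_zero hw0')
      omega
  · have h0 := DFunLike.congr_fun hc 0
    simp at h0
    obtain ⟨b, hb, rfl⟩ := (Nat.dvd_prime_pow hp).1 ⟨w 0, h0.symm⟩
    refine (obstruction_le_mul (e := p ^ (a - b)) (pow_ne_zero _ hp.ne_zero)).trans ?_
    rw [← pow_add, Nat.add_sub_cancel' hb]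
    exact obstruction_anti (Nat.one_le_pow _ _ hp.pos)
  · refine lt_of_le_of_ne zero_le fun h => ?_
    have := DFunLike.congr_fun h 0
    simp at this
    exact absurd this.symm hq0.ne'

lemma leadingExtends {p : ℕ} (hp : p.Prime) [CharP k p] (ord : MonomialOrder (Fin 2)) (n : ℕ) :
    LeadingExtends k A ord n := by
  induction n using Nat.strong_induction_on with
  | _ n ih =>
    exact leadingExtends_of_lt ord hp (fun c hc hc0 =>
      obstructionReduces_of_lt hp ord hc0 fun m hm => ih m (hm.trans_le hc)) ih

/-- In characteristic `p`, the leading coefficient of a one-variable series that is multiplicative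
modulo `X^N` is the linear coefficient of a series multiplicative modulo `X^(N/j)`. -/
lemma IsJet.coeff_mem_leading {p : ℕ} (hp : p.Prime) [CharP k p] {N n j : ℕ}
    {γ : PowerSeries (Module.End k A)} (h : IsJet N γ) (hj : j ≠ 0)
    (hz : ∀ i, 0 < i → i < j → PowerSeries.coeff i γ = 0) (hn : n * j < N) :
    PowerSeries.coeff j γ ∈ leading k A (n + 1) := by
  have hs {i : ℕ} (hi : i ≠ 0) : (Finsupp.single 0 i : Fin 2 →₀ ℕ) ≠ 0 := by simpa using hi
  have hi (i : ℕ) : i • (Finsupp.single 0 1 : Fin 2 →₀ ℕ) = Finsupp.single 0 i := by simp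
  have hL := leadingExtends (k := k) (A := A) hp (MonomialOrder.lex (σ := Fin 2)) n
    (Finsupp.single 0 j) (subst (MvPowerSeries.monomial (Finsupp.single 0 1) (1 : k)) γ) (hs hj)
    (by rw [coeff_zero_subst, h.1]) (fun e he => ?_) fun e he he0 hej => ?_
  · rwa [← hi, coeff_subst_monomial_smul (hs one_ne_zero)] at hL
  · refine h.coeff_defect_subst (hs one_ne_zero) fun c hc => ?_
    rw [← hc] at he
    have := he 0
    simp at this
    omega
  · by_cases hc : ∃ c : ℕ, c • (Finsupp.single 0 1 : Fin 2 →₀ ℕ) = e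
    · obtain ⟨c, rfl⟩ := hc
      rw [coeff_subst_monomial_smul (hs one_ne_zero)]
      refine hz c (Nat.pos_of_ne_zero ?_) (lt_of_not_ge fun hcj => ?_)
      · rintro rfl
        simp at he0
      · rw [hi] at hej
        exact hej.not_ge (MonomialOrder.toSyn_monotone _ (Finsupp.single_mono hcj))
    · push Not at hc
      exact coeff_subst_monomial_of_forall_ne hc _

end Reduction

section Integration

lemma coeff_powerSeries_defect_eq_zero_iff {k A : Type*} [CommRing k] [Ring A] [Algebra k A]
    (γ : PowerSeries (Module.End k A)) (i : ℕ) :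
    PowerSeries.coeff i (defect γ) = 0 ↔ ∀ x y : A, PowerSeries.coeff i γ (x * y) =
      ∑ j ∈ range (i + 1), PowerSeries.coeff j γ x * PowerSeries.coeff (i - j) γ y := by
  classical
  refine (coeff_defect_eq_zero_iff γ (Finsupp.single () i)).trans
    (forall_congr' fun x => forall_congr' fun y => ?_)
  rw [← Nat.sum_antidiagonal_eq_sum_range_succ
    (fun a b => PowerSeries.coeff a γ x * PowerSeries.coeff b γ y), Finsupp.antidiagonal_single,
    sum_map]
  rfl

variable {k A : Type*} [Field k] [Ring A] [Algebra k A]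

lemma IsJet.pow {n : ℕ} {γ : PowerSeries (Module.End k A)} (h : IsJet n γ) (m : ℕ) :
    IsJet n (γ ^ m) := by
  induction m with
  | zero => simpa using isJet_one n
  | succ m ih => rw [pow_succ]; exact ih.mul h

lemma IsJet.exists_extension {p : ℕ} (hp : p.Prime) [CharP k p] {n₀ : ℕ}
    (hst : ∀ m, leading k A n₀ ≤ leading k A m) {N n : ℕ} {γ : PowerSeries (Module.End k A)}
    (h : IsJet N γ) (hN : n₀ * n < N) (M : ℕ) :
    ∃ γ', IsJet (max M N) γ' ∧ ∀ i ≤ n, PowerSeries.coeff i γ' = PowerSeries.coeff i γ := by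
  induction n with
  | zero =>
    refine ⟨1, isJet_one _, fun i hi => ?_⟩
    obtain rfl : i = 0 := by omega
    rw [h.1, PowerSeries.coeff_zero_one]
  | succ n ih =>
    obtain ⟨γ', hγ', hag⟩ := ih (by nlinarith)
    obtain ⟨δ, hδ, hδ'⟩ := h.exists_mul_eq (hγ'.mono (le_max_right M N))
    have hδz : ∀ i, 0 < i → i < n + 1 → PowerSeries.coeff i δ = 0 := fun i hi hin => by
      refine coeff_eq_zero_of_mul_eq hδ'.coeff_zero hγ'.coeff_zero hδ (fun e he => ?_)
        (by simpa using hi.ne')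
      obtain ⟨j, hj, rfl⟩ := exists_single_of_lt (he.trans_lt (single_lt_single i.lt_succ_self))
      exact (hag j (by omega)).symm
    obtain ⟨ψ, hψ, hψ'⟩ := hst (max M N) (leading_anti n₀.le_succ
      (hδ'.coeff_mem_leading hp n.succ_ne_zero hδz hN))
    have hψM : IsJet (max M N) (HasseSchmidt.expand (n + 1) ψ) :=
      hψ.expand n.succ_ne_zero (Nat.le_mul_of_pos_right _ n.succ_pos)
    refine ⟨HasseSchmidt.expand (n + 1) ψ * γ', hψM.mul hγ', fun i hi => ?_⟩
    rw [← hδ, PowerSeries.coeff_mul, PowerSeries.coeff_mul]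
    refine sum_congr rfl fun x hx => congrArg (· * _) ?_
    have hxi : x.1 ≤ n + 1 := by
      rw [HasAntidiagonal.mem_antidiagonal] at hx
      omega
    rcases Nat.eq_zero_or_pos x.1 with h0 | h0
    · rw [h0, hψM.1, hδ'.1]
    rcases hxi.eq_or_lt with h1 | h1
    · have := coeff_expand n.succ_ne_zero ψ 1
      rw [one_mul] at this
      rw [h1, ← hψ', this]
    · rw [hδz _ h0 h1, coeff_expand_of_not_dvd (Nat.not_dvd_of_pos_of_lt h0 h1)]

lemma exists_leading_le [FiniteDimensional k A] :
    ∃ n₀, ∀ m, leading k A n₀ ≤ leading k A m := by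
  obtain ⟨n₀, h⟩ := IsArtinian.monotone_stabilizes (R := k) (M := Module.End k A)
    ⟨fun n => OrderDual.toDual (leading k A n), fun _ _ h => leading_anti h⟩
  refine ⟨n₀, fun m => ?_⟩
  rcases le_total n₀ m with hm | hm
  · exact (OrderDual.toDual.injective (h m hm)).le
  · exact leading_anti hm

/-- Over a finite-dimensional algebra of characteristic `p`, a linear map which is a linear
coefficient of series multiplicative to every finite order is one of a multiplicative series. -/
lemma exists_isJet_of_mem_leading [FiniteDimensional k A] {p : ℕ} (hp : p.Prime) [CharP k p]
    {D : Module.End k A} (hD : ∀ n, D ∈ leading k A n) :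
    ∃ γ : PowerSeries (Module.End k A), (∀ n, IsJet n γ) ∧ PowerSeries.coeff 1 γ = D := by
  obtain ⟨n₀, hst⟩ := exists_leading_le (k := k) (A := A)
  have hext (n : ℕ) (γ : {γ : PowerSeries (Module.End k A) // IsJet ((n₀ + 1) * (n + 2)) γ}) :
      ∃ γ' : {γ' : PowerSeries (Module.End k A) // IsJet ((n₀ + 1) * (n + 1 + 2)) γ'},
        ∀ i ≤ n + 1, PowerSeries.coeff i γ'.1 = PowerSeries.coeff i γ.1 := by
    obtain ⟨γ', h, h'⟩ := γ.2.exists_extension hp hst (n := n + 1) (by nlinarith)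
      ((n₀ + 1) * (n + 1 + 2))
    exact ⟨⟨γ', h.mono (le_max_left _ _)⟩, h'⟩
  choose f hf using hext
  obtain ⟨γ₀, hγ₀, hγ₀D⟩ := hD ((n₀ + 1) * (0 + 2))
  let g : ∀ n, {γ : PowerSeries (Module.End k A) // IsJet ((n₀ + 1) * (n + 2)) γ} :=
    Nat.rec ⟨γ₀, hγ₀⟩ f
  have hg {i n : ℕ} (hi : i ≤ n + 1) (m : ℕ) :
      PowerSeries.coeff i (g (n + m)).1 = PowerSeries.coeff i (g n).1 := by
    induction m with
    | zero => rfl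
    | succ m ih => exact (hf (n + m) (g (n + m)) i (by omega)).trans ih
  let γ : PowerSeries (Module.End k A) := PowerSeries.mk fun i => PowerSeries.coeff i (g i).1
  have hγ {i n : ℕ} (hi : i ≤ n) : PowerSeries.coeff i γ = PowerSeries.coeff i (g n).1 := by
    obtain ⟨m, rfl⟩ := Nat.exists_eq_add_of_le hi
    rw [PowerSeries.coeff_mk, hg i.le_succ]
  have hγ0 : PowerSeries.coeff 0 γ = 1 := by rw [hγ le_rfl, (g 0).2.1]
  refine ⟨γ, fun n => ⟨hγ0, fun i _ => ?_⟩, ?_⟩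
  · rw [← (g i).2.2 i (by nlinarith)]
    refine coeff_defect_congr (by rw [← coeff_zero_powerSeries, hγ0]) fun e he => ?_
    obtain ⟨j, hj, rfl⟩ := exists_single_of_lt (he.trans_lt (single_lt_single i.lt_succ_self))
    exact hγ (Nat.le_of_lt_succ hj)
  · rw [hγ le_rfl, ← hγ₀D]
    exact hg (n := 0) le_rfl 1

lemma coeff_pow_char {R : Type*} [Ring R] [Algebra k R] {p : ℕ} (hp : p.Prime) [CharP k p]
    {γ : PowerSeries R} (hγ : PowerSeries.coeff 0 γ = 1) :
    (∀ i, 0 < i → i < p → PowerSeries.coeff i (γ ^ p) = 0) ∧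
      PowerSeries.coeff p (γ ^ p) = PowerSeries.coeff 1 γ ^ p := by
  have hp0 : (p : PowerSeries R) = 0 := by
    rw [← map_natCast (algebraMap k (PowerSeries R)), CharP.cast_eq_zero, map_zero]
  set ψ : PowerSeries R := PowerSeries.mk fun n => PowerSeries.coeff (n + 1) γ with hψ
  have h1 : γ = PowerSeries.X * ψ + 1 := by
    conv_lhs => rw [PowerSeries.eq_X_mul_shift_add_const γ]
    rw [← PowerSeries.coeff_zero_eq_constantCoeff_apply, hγ, map_one]
  have h2 : γ ^ p = PowerSeries.X ^ p * ψ ^ p + 1 := by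
    rw [h1, (Commute.one_right _).add_pow_prime_eq hp, hp0,
      (PowerSeries.commute_X ψ).symm.mul_pow, one_pow]
    simp
  rw [h2]
  refine ⟨fun i hi hip => ?_, ?_⟩
  · rw [map_add, PowerSeries.coeff_X_pow_mul', if_neg hip.not_ge, PowerSeries.coeff_one,
      if_neg hi.ne', add_zero]
  · rw [map_add, PowerSeries.coeff_X_pow_mul', if_pos le_rfl, PowerSeries.coeff_one,
      if_neg hp.ne_zero, add_zero, Nat.sub_self, PowerSeries.coeff_zero_eq_constantCoeff_apply,
      map_pow, ← PowerSeries.coeff_zero_eq_constantCoeff_apply, hψ, PowerSeries.coeff_mk]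

end Integration

end HasseSchmidt

/-- Over a field `k` of characteristic `p > 0`, for a finite-dimensional
`k`-algebra `A`, the `p`-th power of an integrable (`[1,∞]`-integrable)
derivation is an integrable derivation: the integrable derivations form a
restricted Lie subalgebra of `Der(A)`. -/
theorem statement9 (k : Type*) [Field k] (p : ℕ) (hp : 0 < p) [CharP k p]
    (A : Type*) [Ring A] [Algebra k A] [FiniteDimensional k A]
    (D : A →ₗ[k] A) (hD : IsDerivation k A D)
    (h : IsInfIntegrable k A 1 D) :
    IsDerivation k A (D ^ p) ∧ IsInfIntegrable k A 1 (D ^ p) := by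
  have hprime : p.Prime := (CharP.char_is_prime_or_zero k p).resolve_right hp.ne'
  suffices hI : IsInfIntegrable k A 1 (D ^ p) by
    refine ⟨?_, hI⟩
    obtain ⟨α, h0, -, h1, hα⟩ := hI
    intro x y
    have := hα 1 x y
    rw [Finset.sum_range_succ, Finset.sum_range_one, Nat.sub_self, Nat.sub_zero, h0, h1] at this
    rw [this, add_comm]
    rfl
  obtain ⟨α, h0, -, h1, hα⟩ := h
  let β : PowerSeries (Module.End k A) := PowerSeries.mk α
  have hβ (n : ℕ) : HasseSchmidt.IsJet n β := by
    refine ⟨(PowerSeries.coeff_mk 0 α).trans h0, fun i _ => ?_⟩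
    rw [HasseSchmidt.coeff_powerSeries_defect_eq_zero_iff]
    simpa only [β, PowerSeries.coeff_mk] using hα i
  obtain ⟨hz, hc⟩ := HasseSchmidt.coeff_pow_char (k := k) hprime (hβ 0).1
  rw [PowerSeries.coeff_mk, h1] at hc
  obtain ⟨γ, hγ, hγ'⟩ := HasseSchmidt.exists_isJet_of_mem_leading hprime (D := D ^ p) fun n => by
    rw [← hc]
    exact HasseSchmidt.leading_anti n.le_succ
      (((hβ (n * p + 1)).pow p).coeff_mem_leading hprime hprime.ne_zero hz (Nat.lt_succ_self _))
  refine ⟨fun i => PowerSeries.coeff i γ, (hγ 0).1, fun i hi hi' => by omega, hγ', fun i x y => ?_⟩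
  exact (HasseSchmidt.coeff_powerSeries_defect_eq_zero_iff γ i).1 ((hγ (i + 1)).2 i i.lt_succ_self)
    x y
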